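/- arXiv:2408.14067 — 3 statements merged into one kernel-verified Lean document; each statement's English description precedes it below -/
import Mathlib

section
/- Let c₀ ∈ ℝ³, r₁ > 0, σ > 0, and let x₁,…,x_M ∈ ℝ³ be measurement locations with ‖x_m − c₀‖ ≤ r₁ for every m = 1,…,M. Let X̃ be the M×4 design matrix whose m-th row is (1, (x_m − c₀)ᵀ), and assume X̃ᵀX̃ is invertible. Then tr(σ²(X̃ᵀX̃)⁻¹) ≥ σ²/M + 9σ²/(M r₁²). -/
open Matrix Finset

/-- The `M × 4` design matrix whose `m`-th row is `(1, (x m − c₀)ᵀ)`. -/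
noncomputable def designMatrix {M : ℕ} (x : Fin M → EuclideanSpace ℝ (Fin 3))
    (c₀ : EuclideanSpace ℝ (Fin 3)) : Matrix (Fin M) (Fin 4) ℝ :=
  Matrix.of fun m => Fin.cons 1 fun i => x m i - c₀ i

/-- For positive semidefinite invertible `A` and `D = diagonal d`, expanding
`0 ≤ tr ((A⁻¹ - D) A (A⁻¹ - D))` bounds the trace of `A⁻¹` from below. -/
theorem Matrix.PosSemidef.sum_le_trace_inv {n : Type*} [Fintype n] [DecidableEq n]
    {A : Matrix n n ℝ} (hA : A.PosSemidef) (hdet : IsUnit A.det) (d : n → ℝ) :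
    ∑ i, (2 * d i - d i ^ 2 * A i i) ≤ A⁻¹.trace := by
  have hB : (A⁻¹ - diagonal d)ᴴ = A⁻¹ - diagonal d := by
    rw [conjTranspose_sub, hA.inv.isHermitian.eq, diagonal_conjTranspose, star_trivial]
  have hpos := (hA.conjTranspose_mul_mul_same (A⁻¹ - diagonal d)).trace_nonneg
  have hexpand : (A⁻¹ - diagonal d) * A * (A⁻¹ - diagonal d) =
      A⁻¹ - diagonal d - diagonal d + diagonal d * A * diagonal d := by
    rw [sub_mul, nonsing_inv_mul _ hdet, sub_mul, one_mul, mul_sub,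
      mul_nonsing_inv_cancel_right _ _ hdet]
    abel
  have htrace : (diagonal d * A * diagonal d).trace = ∑ i, d i ^ 2 * A i i := by
    simp only [trace, diag_apply, mul_diagonal, diagonal_mul]
    exact Finset.sum_congr rfl fun i _ => by ring
  rw [hB, hexpand, trace_add, trace_sub, trace_sub, htrace, trace_diagonal] at hpos
  rw [Finset.sum_sub_distrib, ← Finset.mul_sum]
  linarith

theorem designMatrix_gram_zero {M : ℕ} (x : Fin M → EuclideanSpace ℝ (Fin 3))
    (c₀ : EuclideanSpace ℝ (Fin 3)) :
    ((designMatrix x c₀)ᵀ * designMatrix x c₀) 0 0 = M := by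
  simp [mul_apply, designMatrix]

theorem sum_designMatrix_gram_succ {M : ℕ} (x : Fin M → EuclideanSpace ℝ (Fin 3))
    (c₀ : EuclideanSpace ℝ (Fin 3)) :
    ∑ i : Fin 3, ((designMatrix x c₀)ᵀ * designMatrix x c₀) i.succ i.succ =
      ∑ m, ‖x m - c₀‖ ^ 2 := by
  simp only [mul_apply, transpose_apply, designMatrix, of_apply, Fin.cons_succ]
  rw [Finset.sum_comm]
  refine Finset.sum_congr rfl fun m _ => ?_
  simp [EuclideanSpace.norm_sq_eq, ← sq]

/-- If all measurement locations satisfy `‖x m − c₀‖ ≤ r₁` and the Gram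
matrix `X̃ᵀX̃` is invertible, then `tr(σ²(X̃ᵀX̃)⁻¹) ≥ σ²/M + 9σ²/(M r₁²)`. -/
theorem trace_variance_lower_bound {M : ℕ} (c₀ : EuclideanSpace ℝ (Fin 3))
    (r₁ σ : ℝ) (hr₁ : 0 < r₁) (hσ : 0 < σ)
    (x : Fin M → EuclideanSpace ℝ (Fin 3))
    (hx : ∀ m, ‖x m - c₀‖ ≤ r₁)
    (hinv : IsUnit ((designMatrix x c₀)ᵀ * designMatrix x c₀).det) :
    σ ^ 2 / M + 9 * σ ^ 2 / (M * r₁ ^ 2) ≤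
      (σ ^ 2 • ((designMatrix x c₀)ᵀ * designMatrix x c₀)⁻¹).trace := by
  have hpsd : ((designMatrix x c₀)ᵀ * designMatrix x c₀).PosSemidef := by
    simpa using posSemidef_conjTranspose_mul_self (designMatrix x c₀)
  have hM : (0 : ℝ) < M := by
    rcases Nat.eq_zero_or_pos M with rfl | h
    · simp [Subsingleton.elim (designMatrix x c₀) 0] at hinv
    · exact_mod_cast h
  have hsum : ∑ m, ‖x m - c₀‖ ^ 2 ≤ M * r₁ ^ 2 := by
    have h : ∑ m, ‖x m - c₀‖ ^ 2 ≤ ∑ _m : Fin M, r₁ ^ 2 :=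
      Finset.sum_le_sum fun m _ => pow_le_pow_left₀ (norm_nonneg _) (hx m) 2
    simpa using h
  have hbound : 1 / (M : ℝ) + 9 / (M * r₁ ^ 2) ≤
      ((designMatrix x c₀)ᵀ * designMatrix x c₀)⁻¹.trace := by
    have h := hpsd.sum_le_trace_inv hinv
      (Fin.cons (1 / (M : ℝ)) fun _ => 3 / (M * r₁ ^ 2))
    rw [Fin.sum_univ_succ] at h
    simp only [Fin.cons_zero, Fin.cons_succ] at h
    rw [designMatrix_gram_zero, Finset.sum_sub_distrib, ← Finset.mul_sum, ← Finset.mul_sum,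
      sum_designMatrix_gram_succ, Finset.sum_const, Finset.card_univ, Fintype.card_fin,
      nsmul_eq_mul] at h
    have hmul := mul_le_mul_of_nonneg_left hsum (sq_nonneg (3 / (M * r₁ ^ 2)))
    have hconst : (3 / (M * r₁ ^ 2)) ^ 2 * (M * r₁ ^ 2) = 9 / (M * r₁ ^ 2) := by
      field_simp
      norm_num
    have hzero : 2 * (1 / (M : ℝ)) - (1 / (M : ℝ)) ^ 2 * M = 1 / M := by
      field_simp
      norm_num
    have hlin : ((3 : ℕ) : ℝ) * (2 * (3 / (M * r₁ ^ 2))) = 2 * (9 / (M * r₁ ^ 2)) := by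
      push_cast
      ring
    linarith
  rw [trace_smul, smul_eq_mul]
  calc σ ^ 2 / M + 9 * σ ^ 2 / (M * r₁ ^ 2)
      = σ ^ 2 * (1 / (M : ℝ) + 9 / (M * r₁ ^ 2)) := by ring
    _ ≤ _ := mul_le_mul_of_nonneg_left hbound (sq_nonneg σ)
end

section
/- Let M ≥ 2 be an integer, r₁ ≥ 0, H₀ ≥ 0, R ≥ 0, and set ω = 4π/M and v = 2/√(M² − 1). Then for every T with 0 ≤ T ≤ π(H₀ + R)/v, the spiral trajectory length satisfies T·√(2 r₁² ω²/3 + v²) ≤ π(H₀ + R)·√(3π² r₁² + 1). In particular, π(H₀+R)/v · √(2 r₁² ω²/3 + v²) = π(H₀ + R)·√(8(M² − 1)π² r₁²/(3M²) + 1) ≤ π(H₀ + R)·√(3π² r₁² + 1). -/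
open Real

/-- With `ω = 4π/M` and `v = 2/√(M² − 1)`, for every search time
`0 ≤ T ≤ π(H₀ + R)/v` the spiral trajectory length satisfies
`T √(2r₁²ω²/3 + v²) ≤ π(H₀ + R) √(3π²r₁² + 1)`; moreover the extreme value equals
`π(H₀ + R) √(8(M² − 1)π²r₁²/(3M²) + 1)` which is at most `π(H₀ + R) √(3π²r₁² + 1)`. -/
theorem spiral_trajectory_length_bound
    (M : ℕ) (hM : 2 ≤ M) (r₁ H₀ R : ℝ) (hr₁ : 0 ≤ r₁) (hH₀ : 0 ≤ H₀) (hR : 0 ≤ R) :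
    letI ω : ℝ := 4 * π / M
    letI v : ℝ := 2 / Real.sqrt ((M : ℝ) ^ 2 - 1)
    (∀ T : ℝ, 0 ≤ T → T ≤ π * (H₀ + R) / v →
        T * Real.sqrt (2 * r₁ ^ 2 * ω ^ 2 / 3 + v ^ 2) ≤
          π * (H₀ + R) * Real.sqrt (3 * π ^ 2 * r₁ ^ 2 + 1)) ∧
      π * (H₀ + R) / v * Real.sqrt (2 * r₁ ^ 2 * ω ^ 2 / 3 + v ^ 2) =
        π * (H₀ + R) *
          Real.sqrt (8 * ((M : ℝ) ^ 2 - 1) * π ^ 2 * r₁ ^ 2 / (3 * (M : ℝ) ^ 2) + 1) ∧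
      π * (H₀ + R) *
          Real.sqrt (8 * ((M : ℝ) ^ 2 - 1) * π ^ 2 * r₁ ^ 2 / (3 * (M : ℝ) ^ 2) + 1) ≤
        π * (H₀ + R) * Real.sqrt (3 * π ^ 2 * r₁ ^ 2 + 1) := by
  have hM2 : (2 : ℝ) ≤ M := by exact_mod_cast hM
  have hM0 : (0 : ℝ) < M := by linarith
  have hq : 0 < (M : ℝ) ^ 2 - 1 := by nlinarith
  have hL : 0 ≤ π * (H₀ + R) := by positivity
  have hv : 0 < 2 / √((M : ℝ) ^ 2 - 1) := by positivity
  have hsum : 2 * r₁ ^ 2 * (4 * π / M) ^ 2 / 3 + (2 / √((M : ℝ) ^ 2 - 1)) ^ 2 =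
      (2 / √((M : ℝ) ^ 2 - 1)) ^ 2 *
        (8 * ((M : ℝ) ^ 2 - 1) * π ^ 2 * r₁ ^ 2 / (3 * (M : ℝ) ^ 2) + 1) := by
    rw [div_pow 2 √_, Real.sq_sqrt hq.le]
    field_simp
    ring
  have heq : π * (H₀ + R) / (2 / √((M : ℝ) ^ 2 - 1)) *
      √(2 * r₁ ^ 2 * (4 * π / M) ^ 2 / 3 + (2 / √((M : ℝ) ^ 2 - 1)) ^ 2) =
      π * (H₀ + R) * √(8 * ((M : ℝ) ^ 2 - 1) * π ^ 2 * r₁ ^ 2 / (3 * (M : ℝ) ^ 2) + 1) := by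
    rw [hsum, Real.sqrt_mul (sq_nonneg _), Real.sqrt_sq hv.le, ← mul_assoc,
      div_mul_cancel₀ _ hv.ne']
  have hle : π * (H₀ + R) *
      √(8 * ((M : ℝ) ^ 2 - 1) * π ^ 2 * r₁ ^ 2 / (3 * (M : ℝ) ^ 2) + 1) ≤
      π * (H₀ + R) * √(3 * π ^ 2 * r₁ ^ 2 + 1) := by
    refine mul_le_mul_of_nonneg_left (Real.sqrt_le_sqrt ?_) hL
    gcongr
    rw [div_le_iff₀ (by positivity)]
    have hx : 0 ≤ π ^ 2 * r₁ ^ 2 := by positivity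
    nlinarith [mul_nonneg hx (sq_nonneg (M : ℝ))]
  refine ⟨fun T _ hT => ?_, heq, hle⟩
  exact (mul_le_mul_of_nonneg_right hT (Real.sqrt_nonneg _)).trans (heq.trans_le hle)
end

section
/- Let M be an even integer with M ≥ 6, let r₁ > 0, let c₀ ∈ ℝ³, and set ω = 4π/M. For m = 1,…,M define x_m = c₀ + (a_m, b_m, c_m) where a_m = √(2/3)·r₁·cos(ω(m − 1/2)), b_m = (2 r₁/√(M² − 1))·(m − 1/2 − M/2), and c_m = √(2/3)·r₁·sin(ω(m − 1/2))·ε_m with ε_m = 1 if m ≤ M/2 and ε_m = −1 if m > M/2. Then the points x₁,…,x_M satisfy the measurement-pattern conditions: (i) Σ_{m=1}^{M} a_m = Σ_{m=1}^{M} b_m = Σ_{m=1}^{M} c_m = 0; (ii) Σ_{m=1}^{M} a_m b_m = Σ_{m=1}^{M} a_m c_m = Σ_{m=1}^{M} b_m c_m = 0; (iii) Σ_{m=1}^{M} a_m² = Σ_{m=1}^{M} b_m² = Σ_{m=1}^{M} c_m² = M r₁²/3. -/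
open Real Finset

/-- Telescoping form of the sum of cosines at the half-integer multiples of `x`. -/
theorem sum_range_cos_half_mul_two_sin_half (x : ℝ) (n : ℕ) :
    (∑ i ∈ range n, cos (x * ((i : ℝ) + 1 / 2))) * (2 * sin (x / 2)) = sin (n * x) := by
  induction n with
  | zero => simp
  | succ k ih =>
    have hsub : (k : ℝ) * x = x * ((k : ℝ) + 1 / 2) - x / 2 := by ring
    have hadd : ((k + 1 : ℕ) : ℝ) * x = x * ((k : ℝ) + 1 / 2) + x / 2 := by push_cast; ring
    rw [sum_range_succ, add_mul, ih, hadd, hsub, sin_sub, sin_add]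
    ring

theorem sum_range_cos_half_eq_zero (n k : ℕ) (hk : 0 < k) (hkn : k < n) :
    ∑ i ∈ range n, cos (2 * π * k / n * ((i : ℝ) + 1 / 2)) = 0 := by
  have hk' : (0 : ℝ) < k := by exact_mod_cast hk
  have hkn' : (k : ℝ) < n := by exact_mod_cast hkn
  have hn : (0 : ℝ) < n := hk'.trans hkn'
  have hsin : 0 < sin (2 * π * k / n / 2) := by
    apply sin_pos_of_pos_of_lt_pi
    · positivity
    · rw [div_div, div_lt_iff₀ (by positivity)]
      nlinarith [pi_pos]
  have h := sum_range_cos_half_mul_two_sin_half (2 * π * k / n) n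
  have hangle : (n : ℝ) * (2 * π * k / n) = ((2 * k : ℕ) : ℝ) * π := by
    push_cast
    field_simp
  rw [hangle, sin_nat_mul_pi] at h
  exact (mul_eq_zero.mp h).resolve_right (by positivity)

theorem sum_range_eq_zero_of_reflect_neg (n : ℕ) (f : ℕ → ℝ)
    (h : ∀ i < n, f (n - 1 - i) = -f i) : ∑ i ∈ range n, f i = 0 := by
  have hsum : ∑ i ∈ range n, f i = -∑ i ∈ range n, f i := by
    rw [← sum_neg_distrib, ← sum_range_reflect f n]
    exact sum_congr rfl fun i hi => h i (mem_range.mp hi)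
  linarith

theorem sum_range_eq_zero_of_shift_neg (N : ℕ) (f : ℕ → ℝ)
    (h : ∀ i < N, f (N + i) = -f i) : ∑ i ∈ range (N + N), f i = 0 := by
  rw [sum_range_add, sum_congr rfl fun i hi => h i (mem_range.mp hi), sum_neg_distrib,
    add_neg_cancel]

theorem sum_range_half_sub_sq (n : ℕ) (t : ℝ) :
    ∑ i ∈ range n, ((i : ℝ) + 1 / 2 - t) ^ 2 =
      n * ((n : ℝ) ^ 2 - 1) / 12 + n * ((n : ℝ) / 2 - t) ^ 2 := by
  induction n with
  | zero => simp
  | succ k ih =>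
    rw [sum_range_succ, ih]
    push_cast
    ring

/-- The samples `x_m = c₀ + (a_m, b_m, c_m)` of the alternating spiral
trajectory satisfy the optimal measurement-pattern conditions (i)–(iii). Here `m`
ranges over `1, …, M` and is represented by `i.val + 1` for `i : Fin M`. -/
theorem alternating_spiral_satisfies_pattern
    (M : ℕ) (hM : 6 ≤ M) (hMeven : Even M) (r₁ : ℝ) (hr₁ : 0 < r₁)
    (c₀ : EuclideanSpace ℝ (Fin 3)) :
    letI ω : ℝ := 4 * π / M
    letI a : Fin M → ℝ := fun i =>
      Real.sqrt (2 / 3) * r₁ * Real.cos (ω * ((i : ℝ) + 1 / 2))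
    letI b : Fin M → ℝ := fun i =>
      2 * r₁ / Real.sqrt ((M : ℝ) ^ 2 - 1) * ((i : ℝ) + 1 / 2 - (M : ℝ) / 2)
    letI c : Fin M → ℝ := fun i =>
      Real.sqrt (2 / 3) * r₁ * Real.sin (ω * ((i : ℝ) + 1 / 2)) *
        (if (i : ℕ) + 1 ≤ M / 2 then 1 else -1)
    ((∑ m, a m = 0) ∧ (∑ m, b m = 0) ∧ (∑ m, c m = 0)) ∧
      ((∑ m, a m * b m = 0) ∧ (∑ m, a m * c m = 0) ∧ (∑ m, b m * c m = 0)) ∧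
      ((∑ m, (a m) ^ 2 = M * r₁ ^ 2 / 3) ∧ (∑ m, (b m) ^ 2 = M * r₁ ^ 2 / 3) ∧
        (∑ m, (c m) ^ 2 = M * r₁ ^ 2 / 3)) := by
  let ω : ℝ := 4 * π / M
  have hM' : (6 : ℝ) ≤ M := by exact_mod_cast hM
  have hM0 : (M : ℝ) ≠ 0 := by positivity
  have hsq : (√(2 / 3 : ℝ)) ^ 2 = 2 / 3 := sq_sqrt (by norm_num)
  set s : ℝ := √(2 / 3)
  set v : ℝ := 2 * r₁ / √((M : ℝ) ^ 2 - 1) with hv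
  let θ : ℕ → ℝ := fun i => ω * ((i : ℝ) + 1 / 2)
  let ε : ℕ → ℝ := fun i => if i + 1 ≤ M / 2 then 1 else -1
  let A : ℕ → ℝ := fun i => s * r₁ * cos (θ i)
  let B : ℕ → ℝ := fun i => v * ((i : ℝ) + 1 / 2 - (M : ℝ) / 2)
  let C : ℕ → ℝ := fun i => s * r₁ * sin (θ i) * ε i
  have toRange (f : ℕ → ℝ) : ∑ m : Fin M, f m = ∑ i ∈ range M, f i := Fin.sum_univ_eq_sum_range f M
  have hcos : ∑ i ∈ range M, cos (θ i) = 0 := by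
    rw [← sum_range_cos_half_eq_zero M 2 (by norm_num) (by lia)]
    refine sum_congr rfl fun i _ => congrArg cos ?_
    simp only [θ, ω]
    push_cast
    ring
  have hcos2 : ∑ i ∈ range M, cos (2 * θ i) = 0 := by
    rw [← sum_range_cos_half_eq_zero M 4 (by norm_num) (by lia)]
    refine sum_congr rfl fun i _ => congrArg cos ?_
    simp only [θ, ω]
    push_cast
    ring
  have castReflect {i : ℕ} (hi : i < M) : ((M - 1 - i : ℕ) : ℝ) = M - 1 - i := by
    rw [Nat.cast_sub (by lia), Nat.cast_sub (by lia), Nat.cast_one]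
  have θreflect {i : ℕ} (hi : i < M) : θ (M - 1 - i) = -θ i + (2 : ℕ) * (2 * π) := by
    simp only [θ, ω, castReflect hi]
    push_cast
    field_simp
    ring
  have Areflect {i : ℕ} (hi : i < M) : A (M - 1 - i) = A i := by
    simp only [A, θreflect hi, cos_add_nat_mul_two_pi, cos_neg]
  have Breflect {i : ℕ} (hi : i < M) : B (M - 1 - i) = -B i := by
    simp only [B, castReflect hi]
    ring
  obtain ⟨N, hN⟩ := hMeven
  have εreflect {i : ℕ} (hi : i < M) : ε (M - 1 - i) = -ε i := by
    simp only [ε]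
    split_ifs <;> first | lia | norm_num
  have Creflect {i : ℕ} (hi : i < M) : C (M - 1 - i) = C i := by
    simp only [C, θreflect hi, sin_add_nat_mul_two_pi, sin_neg, εreflect hi]
    ring
  have θshift (i : ℕ) : θ (N + i) = θ i + 2 * π := by
    have hMN : (M : ℝ) = N + N := by rw [hN, Nat.cast_add]
    have hN0 : (N : ℝ) ≠ 0 := by
      rintro h
      simp [hMN, h] at hM0
    simp only [θ, ω, hMN]
    push_cast
    field_simp
    ring
  have εshift {i : ℕ} (hi : i < N) : ε (N + i) = -ε i := by
    simp only [ε]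
    split_ifs <;> lia
  have Ashift (i : ℕ) : A (N + i) = A i := by
    simp only [A, θshift, cos_add_two_pi]
  have Cshift {i : ℕ} (hi : i < N) : C (N + i) = -C i := by
    simp only [C, θshift, sin_add_two_pi, εshift hi]
    ring
  have εsq (i : ℕ) : ε i ^ 2 = 1 := by
    simp only [ε]
    split_ifs <;> norm_num
  refine ⟨⟨(toRange A).trans ?_, (toRange B).trans ?_, (toRange C).trans ?_⟩,
    ⟨(toRange fun i => A i * B i).trans ?_, (toRange fun i => A i * C i).trans ?_,
      (toRange fun i => B i * C i).trans ?_⟩,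
    ⟨(toRange fun i => A i ^ 2).trans ?_, (toRange fun i => B i ^ 2).trans ?_,
      (toRange fun i => C i ^ 2).trans ?_⟩⟩
  · rw [← mul_sum, hcos, mul_zero]
  · exact sum_range_eq_zero_of_reflect_neg M B fun i hi => Breflect hi
  · rw [hN]
    exact sum_range_eq_zero_of_shift_neg N C fun i hi => Cshift hi
  · refine sum_range_eq_zero_of_reflect_neg M _ fun i hi => ?_
    rw [Areflect hi, Breflect hi, mul_neg]
  · rw [hN]
    refine sum_range_eq_zero_of_shift_neg N _ fun i hi => ?_
    rw [Ashift, Cshift hi, mul_neg]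
  · refine sum_range_eq_zero_of_reflect_neg M _ fun i hi => ?_
    rw [Breflect hi, Creflect hi, neg_mul]
  · have hA (i : ℕ) : A i ^ 2 = r₁ ^ 2 / 3 + r₁ ^ 2 / 3 * cos (2 * θ i) := by
      simp only [A, mul_pow, hsq, cos_sq (θ i)]
      ring
    simp only [hA, sum_add_distrib, ← mul_sum, hcos2, sum_const, card_range, nsmul_eq_mul]
    ring
  · have hpos : (0 : ℝ) < (M : ℝ) ^ 2 - 1 := by nlinarith
    simp only [B, mul_pow, ← mul_sum, sum_range_half_sub_sq, hv, div_pow, sq_sqrt hpos.le]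
    field_simp
    ring
  · have hC (i : ℕ) : C i ^ 2 = r₁ ^ 2 / 3 - r₁ ^ 2 / 3 * cos (2 * θ i) := by
      simp only [C, mul_pow, hsq, εsq, sin_sq, cos_sq (θ i)]
      ring
    simp only [hC, sum_sub_distrib, ← mul_sum, hcos2, sum_const, card_range, nsmul_eq_mul]
    ring
end
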